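/- Coercivity of 𝓛_Γ^T with one radial derivative: if α < 10^{-14}, η = 99/100, γ = 1 + α/10, then for every admissible f, (D_z(𝓛_Γ^T(f)), (D_z f)·w²/sin(2θ)^η)_{L²} ≥ (1/4)·‖(D_z f)·w/sin(2θ)^{η/2}‖²_{L²} − 10⁸·E_θ¹(f), where E_θ¹(f) = ‖(D_θ f)·w/sin(2θ)^{γ/2}‖²_{L²} + ‖f·w/sin(2θ)^{η/2}‖²_{L²}. -/

import Mathlib

open Real MeasureTheory Set Filter

noncomputable section

/-- The angular kernel `K(θ) = 3 sin θ cos² θ`. -/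
def Kker (θ : ℝ) : ℝ := 3 * Real.sin θ * Real.cos θ ^ 2

/-- `L₁₂(f)(z) = ∫_z^∞ ∫_0^{π/2} f(r,θ) K(θ)/r dθ dr`. -/
def L12 (f : ℝ → ℝ → ℝ) (z : ℝ) : ℝ :=
  ∫ r in Ioi z, ∫ θ in Icc 0 (π / 2), f r θ * Kker θ / r

/-- The radial weight `w(z) = (1+z)²/z²`. -/
def wgt (z : ℝ) : ℝ := (1 + z) ^ 2 / z ^ 2

/-- `D_θ f = sin(2θ) ∂_θ f`. -/
def Dth (f : ℝ → ℝ → ℝ) (z θ : ℝ) : ℝ := Real.sin (2 * θ) * deriv (fun t => f z t) θ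

/-- `D_z f = z ∂_z f`. -/
def Dzr (f : ℝ → ℝ → ℝ) (z θ : ℝ) : ℝ := z * deriv (fun s => f s θ) z

/-- `Γ(θ) = (sin θ cos² θ)^{α/3}`. -/
def Gam (α θ : ℝ) : ℝ := (Real.sin θ * Real.cos θ ^ 2) ^ (α / 3)

/-- `c = ∫_0^{π/2} Γ(θ) K(θ) dθ`. -/
def cGam (α : ℝ) : ℝ := ∫ θ in Icc 0 (π / 2), Gam α θ * Kker θ

/-- `𝓛(f) = f + z ∂_z f - 2 f/(1+z)`. -/
def Lop (f : ℝ → ℝ → ℝ) (z θ : ℝ) : ℝ :=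
  f z θ + z * deriv (fun s => f s θ) z - 2 * f z θ / (1 + z)

/-- `𝓛_Γ(f) = 𝓛(f) - (2zΓ(θ)/(c(1+z)²)) L₁₂(f)`. -/
def LGam (α : ℝ) (f : ℝ → ℝ → ℝ) (z θ : ℝ) : ℝ :=
  Lop f z θ - 2 * z * Gam α θ / (cGam α * (1 + z) ^ 2) * L12 f z

/-- `ℙ(f)(z,θ) = f(z,θ) - (Γ(θ)/c)(2z²/(1+z)³) L₁₂(f)(0)`. -/
def Pproj (α : ℝ) (f : ℝ → ℝ → ℝ) (z θ : ℝ) : ℝ :=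
  f z θ - Gam α θ / cGam α * (2 * z ^ 2 / (1 + z) ^ 3) * L12 f 0

/-- `𝓛_Γ^T(f) = 𝓛_Γ(f) - ℙ((3/(1+z)) D_θ f)`. -/
def LGamT (α : ℝ) (f : ℝ → ℝ → ℝ) (z θ : ℝ) : ℝ :=
  LGam α f z θ - Pproj α (fun z2 θ2 => 3 / (1 + z2) * Dth f z2 θ2) z θ

/-- The `L²` inner product on `[0,∞) × [0,π/2]` with respect to `dz dθ`. -/
def ip (A B : ℝ → ℝ → ℝ) : ℝ :=
  ∫ z in Ioi (0 : ℝ), ∫ θ in Icc 0 (π / 2), A z θ * B z θ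

/-- `f` is admissible: smooth on `[0,∞) × [0,π/2]` and vanishing for `z` outside a
compact subset of `(0,∞)`. -/
def Admissible (f : ℝ → ℝ → ℝ) : Prop :=
  ContDiff ℝ (⊤ : ℕ∞) (Function.uncurry f) ∧
  ∃ a b : ℝ, 0 < a ∧ ∀ z θ : ℝ, z ∉ Icc a b → f z θ = 0


section Smoothness

variable {f : ℝ → ℝ → ℝ}

theorem hasDerivAt_slice_fst (hf : ContDiff ℝ (⊤ : ℕ∞) (Function.uncurry f)) (z θ : ℝ) :
    HasDerivAt (fun s => f s θ) (fderiv ℝ (Function.uncurry f) (z, θ) (1, 0)) z := by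
  have h := (hf.differentiable (by simp)).differentiableAt (x := (z, θ))
  exact h.hasFDerivAt.comp_hasDerivAt z ((hasDerivAt_id z).prodMk (hasDerivAt_const z θ))

theorem hasDerivAt_slice_snd (hf : ContDiff ℝ (⊤ : ℕ∞) (Function.uncurry f)) (z θ : ℝ) :
    HasDerivAt (fun t => f z t) (fderiv ℝ (Function.uncurry f) (z, θ) (0, 1)) θ := by
  have h := (hf.differentiable (by simp)).differentiableAt (x := (z, θ))
  exact h.hasFDerivAt.comp_hasDerivAt θ ((hasDerivAt_const θ z).prodMk (hasDerivAt_id θ))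

theorem contDiff_fderiv_apply (hf : ContDiff ℝ (⊤ : ℕ∞) (Function.uncurry f)) (v : ℝ × ℝ) :
    ContDiff ℝ (⊤ : ℕ∞) fun x => fderiv ℝ (Function.uncurry f) x v :=
  (hf.fderiv_right (by simp)).clm_apply contDiff_const

theorem contDiff_deriv_fst (hf : ContDiff ℝ (⊤ : ℕ∞) (Function.uncurry f)) :
    ContDiff ℝ (⊤ : ℕ∞) (Function.uncurry fun z θ => deriv (fun s => f s θ) z) := by
  convert contDiff_fderiv_apply hf (1, 0) using 1
  ext ⟨z, θ⟩
  exact (hasDerivAt_slice_fst hf z θ).deriv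

theorem contDiff_deriv_snd (hf : ContDiff ℝ (⊤ : ℕ∞) (Function.uncurry f)) :
    ContDiff ℝ (⊤ : ℕ∞) (Function.uncurry fun z θ => deriv (fun t => f z t) θ) := by
  convert contDiff_fderiv_apply hf (0, 1) using 1
  ext ⟨z, θ⟩
  exact (hasDerivAt_slice_snd hf z θ).deriv

theorem deriv_deriv_comm (hf : ContDiff ℝ (⊤ : ℕ∞) (Function.uncurry f)) (z θ : ℝ) :
    deriv (fun s => deriv (fun t => f s t) θ) z =
      deriv (fun t => deriv (fun s => f s t) z) θ := by
  have hd : Differentiable ℝ (fderiv ℝ (Function.uncurry f)) :=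
    (hf.fderiv_right (m := (⊤ : ℕ∞)) (by simp)).differentiable (by simp)
  have key : ∀ v : ℝ × ℝ, HasFDerivAt (fun x => fderiv ℝ (Function.uncurry f) x v)
      ((fderiv ℝ (fderiv ℝ (Function.uncurry f)) (z, θ)).flip v) (z, θ) := fun v =>
    (ContinuousLinearMap.apply ℝ ℝ v).hasFDerivAt.comp (z, θ) (hd (z, θ)).hasFDerivAt
  have e1 : (fun s => deriv (fun t => f s t) θ) =
      fun s => fderiv ℝ (Function.uncurry f) (s, θ) (0, 1) :=
    funext fun s => (hasDerivAt_slice_snd hf s θ).deriv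
  have e2 : (fun t => deriv (fun s => f s t) z) =
      fun t => fderiv ℝ (Function.uncurry f) (z, t) (1, 0) :=
    funext fun t => (hasDerivAt_slice_fst hf z t).deriv
  have h1 := (key (0, 1)).comp_hasDerivAt z
    ((hasDerivAt_id z).prodMk (hasDerivAt_const z θ))
  have h2 := (key (1, 0)).comp_hasDerivAt θ
    ((hasDerivAt_const θ z).prodMk (hasDerivAt_id θ))
  rw [e1, e2]
  refine h1.deriv.trans (Eq.trans ?_ h2.deriv.symm)
  have hs : IsSymmSndFDerivAt ℝ (Function.uncurry f) (z, θ) :=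
    hf.contDiffAt.isSymmSndFDerivAt (by
      rw [minSmoothness_of_isRCLikeNormedField]
      exact WithTop.coe_le_coe.2 (le_top : (2 : ℕ∞) ≤ ⊤))
  exact hs _ _

theorem contDiff_Dzr (hf : ContDiff ℝ (⊤ : ℕ∞) (Function.uncurry f)) :
    ContDiff ℝ (⊤ : ℕ∞) (Function.uncurry (Dzr f)) :=
  contDiff_fst.mul (contDiff_deriv_fst hf)

theorem contDiff_Dth (hf : ContDiff ℝ (⊤ : ℕ∞) (Function.uncurry f)) :
    ContDiff ℝ (⊤ : ℕ∞) (Function.uncurry (Dth f)) :=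
  (Real.contDiff_sin.comp (contDiff_const.mul contDiff_snd)).mul (contDiff_deriv_snd hf)

theorem hasDerivAt_fst (hf : ContDiff ℝ (⊤ : ℕ∞) (Function.uncurry f)) (z θ : ℝ) :
    HasDerivAt (fun s => f s θ) (deriv (fun s => f s θ) z) z :=
  (hasDerivAt_slice_fst hf z θ).differentiableAt.hasDerivAt

theorem hasDerivAt_snd (hf : ContDiff ℝ (⊤ : ℕ∞) (Function.uncurry f)) (z θ : ℝ) :
    HasDerivAt (fun t => f z t) (deriv (fun t => f z t) θ) θ :=
  (hasDerivAt_slice_snd hf z θ).differentiableAt.hasDerivAt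

theorem Dzr_Dth_comm (hf : ContDiff ℝ (⊤ : ℕ∞) (Function.uncurry f)) (z θ : ℝ) :
    Dzr (Dth f) z θ = Dth (Dzr f) z θ := by
  have h := deriv_deriv_comm hf z θ
  simp only [Dzr, Dth, deriv_const_mul_field', h]
  ring

theorem Dzr_eq_zero {a b : ℝ} (h0 : ∀ z θ : ℝ, z ∉ Icc a b → f z θ = 0) (z θ : ℝ)
    (hz : z ∉ Icc a b) : Dzr f z θ = 0 := by
  have : (fun s => f s θ) =ᶠ[nhds z] fun _ => (0 : ℝ) := by
    filter_upwards [isClosed_Icc.isOpen_compl.mem_nhds hz] with s hs using h0 s θ hs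
  simp [Dzr, this.deriv_eq]

theorem Dth_eq_zero {a b : ℝ} (h0 : ∀ z θ : ℝ, z ∉ Icc a b → f z θ = 0) (z θ : ℝ)
    (hz : z ∉ Icc a b) : Dth f z θ = 0 := by
  have : (fun t => f z t) = fun _ => (0 : ℝ) := funext fun t => h0 z t hz
  simp [Dth, this]

end Smoothness

section RectangleIntegrals

/-- Lebesgue measure on the rectangle `[a,b] × [0,π/2]`. -/
def rectMeasure (a b : ℝ) : Measure (ℝ × ℝ) :=
  (volume.restrict (Icc a b)).prod (volume.restrict (Icc 0 (π / 2)))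

theorem rectMeasure_eq_restrict (a b : ℝ) :
    rectMeasure a b = volume.restrict (Icc a b ×ˢ Icc 0 (π / 2)) := by
  rw [rectMeasure, Measure.prod_restrict, Measure.volume_eq_prod]

theorem integrable_mul_comp_snd {a b : ℝ} {φ : ℝ × ℝ → ℝ} {s : ℝ → ℝ}
    (hφ : ContinuousOn φ (Icc a b ×ˢ Icc 0 (π / 2)))
    (hs : IntegrableOn s (Icc 0 (π / 2))) :
    Integrable (fun x => φ x * s x.2) (rectMeasure a b) := by
  have h1 : Integrable (fun x : ℝ × ℝ => s x.2) (rectMeasure a b) :=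
    Integrable.comp_snd (ν := volume.restrict (Icc 0 (π / 2))) hs _
  have hK : IsCompact (Icc a b ×ˢ Icc 0 (π / 2)) := isCompact_Icc.prod isCompact_Icc
  obtain ⟨C, hC⟩ := hK.exists_bound_of_continuousOn hφ
  refine h1.bdd_mul (c := C) ?_ ?_
  · rw [rectMeasure_eq_restrict]
    exact hφ.aestronglyMeasurable hK.measurableSet
  · rw [rectMeasure_eq_restrict]
    exact (ae_restrict_iff' hK.measurableSet).2 (Eventually.of_forall hC)

theorem ae_rectMeasure {a b : ℝ} {p : ℝ × ℝ → Prop}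
    (h : ∀ z ∈ Icc a b, ∀ θ ∈ Ioo 0 (π / 2), p (z, θ)) :
    ∀ᵐ x ∂rectMeasure a b, p x := by
  have h1 : rectMeasure a b = volume.restrict (Icc a b ×ˢ Ioo 0 (π / 2)) := by
    rw [rectMeasure, ← restrict_Ioo_eq_restrict_Icc (a := (0 : ℝ)), Measure.prod_restrict,
      Measure.volume_eq_prod]
  rw [h1]
  refine (ae_restrict_iff' (measurableSet_Icc.prod measurableSet_Ioo)).2 (Eventually.of_forall ?_)
  rintro ⟨z, θ⟩ ⟨hz, hθ⟩
  exact h z hz θ hθ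

theorem ip_eq_integral_rectMeasure {a b : ℝ} (ha : 0 < a) {A B : ℝ → ℝ → ℝ}
    (h0 : ∀ z θ : ℝ, z ∉ Icc a b → A z θ * B z θ = 0)
    (hint : Integrable (fun x : ℝ × ℝ => A x.1 x.2 * B x.1 x.2) (rectMeasure a b)) :
    ip A B = ∫ x, A x.1 x.2 * B x.1 x.2 ∂rectMeasure a b := by
  rw [rectMeasure, integral_prod _ hint, ip]
  refine setIntegral_eq_of_subset_of_forall_sdiff_eq_zero measurableSet_Ioi
    (fun z hz => ha.trans_le hz.1) ?_
  rintro z ⟨-, hz⟩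
  simp [h0 z _ hz]

theorem sq_integral_mul_le {X : Type*} [MeasurableSpace X] {μ : Measure X} {u v : X → ℝ}
    (hu : Integrable (fun x => u x ^ 2) μ) (hv : Integrable (fun x => v x ^ 2) μ)
    (huv : Integrable (fun x => u x * v x) μ) :
    (∫ x, u x * v x ∂μ) ^ 2 ≤ (∫ x, u x ^ 2 ∂μ) * ∫ x, v x ^ 2 ∂μ := by
  have h : ∀ t : ℝ, 0 ≤ (∫ x, v x ^ 2 ∂μ) * (t * t) + (2 * ∫ x, u x * v x ∂μ) * t
      + ∫ x, u x ^ 2 ∂μ := by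
    intro t
    have h1 : 0 ≤ ∫ x, (u x + t * v x) ^ 2 ∂μ := integral_nonneg fun x => sq_nonneg _
    have h2 : ∫ x, (u x + t * v x) ^ 2 ∂μ =
        ∫ x, ((t * t) * v x ^ 2 + (2 * t) * (u x * v x)) + u x ^ 2 ∂μ := by
      congr 1; ext x; ring
    rw [h2, integral_add (f := fun x => t * t * v x ^ 2 + 2 * t * (u x * v x))
        ((hv.const_mul _).add (huv.const_mul _)) hu,
      integral_add (hv.const_mul _) (huv.const_mul _), integral_const_mul,
      integral_const_mul] at h1
    linarith
  have := discrim_le_zero h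
  rw [discrim] at this
  linarith

end RectangleIntegrals

section AngularWeight

theorem sin_two_mul_pos {θ : ℝ} (hθ : θ ∈ Ioo 0 (π / 2)) : 0 < Real.sin (2 * θ) :=
  Real.sin_pos_of_pos_of_lt_pi (by linarith [hθ.1]) (by linarith [hθ.2])

theorem sin_two_mul_nonneg {θ : ℝ} (hθ : θ ∈ Icc 0 (π / 2)) : 0 ≤ Real.sin (2 * θ) :=
  Real.sin_nonneg_of_nonneg_of_le_pi (by linarith [hθ.1]) (by linarith [hθ.2])

theorem min_le_sin_two_mul {θ : ℝ} (hθ : θ ∈ Ioo 0 (π / 2)) :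
    min (2 / π * θ) (2 / π * (π / 2 - θ)) ≤ Real.sin (2 * θ) := by
  have h1 := Real.mul_le_sin hθ.1.le hθ.2.le
  have h2 := Real.mul_le_sin (x := π / 2 - θ) (by linarith [hθ.2]) (by linarith [hθ.1])
  rw [Real.sin_pi_div_two_sub] at h2
  rw [Real.sin_two_mul]
  have hp := Real.pi_pos
  have hx : 0 < 2 / π * θ := mul_pos (by positivity) hθ.1
  have hy : 0 < 2 / π * (π / 2 - θ) := mul_pos (by positivity) (by linarith [hθ.2])
  have hxy : 2 / π * θ + 2 / π * (π / 2 - θ) = 1 := by field_simp; ring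
  have h3 := mul_le_mul h1 h2 hy.le (hx.le.trans h1)
  rcases le_total (2 / π * θ) (2 / π * (π / 2 - θ)) with h | h
  · rw [min_eq_left h]; nlinarith
  · rw [min_eq_right h]; nlinarith

/-- The singular angular weight `sin(2θ)^{-η}`. -/
def angWt (η θ : ℝ) : ℝ := (Real.sin (2 * θ) ^ η)⁻¹

theorem measurable_angWt (η : ℝ) : Measurable (angWt η) := by
  unfold angWt; fun_prop

theorem angWt_nonneg (η : ℝ) {θ : ℝ} (hθ : θ ∈ Icc 0 (π / 2)) : 0 ≤ angWt η θ :=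
  inv_nonneg.2 (Real.rpow_nonneg (sin_two_mul_nonneg hθ) _)

theorem one_le_angWt {η : ℝ} (hη : 0 ≤ η) {θ : ℝ} (hθ : θ ∈ Ioo 0 (π / 2)) :
    1 ≤ angWt η θ :=
  (one_le_inv₀ (Real.rpow_pos_of_pos (sin_two_mul_pos hθ) _)).2
    (Real.rpow_le_one (sin_two_mul_pos hθ).le (Real.sin_le_one _) hη)

theorem angWt_mono {η γ : ℝ} (h : η ≤ γ) {θ : ℝ} (hθ : θ ∈ Ioo 0 (π / 2)) :
    angWt η θ ≤ angWt γ θ :=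
  inv_anti₀ (Real.rpow_pos_of_pos (sin_two_mul_pos hθ) _)
    (Real.rpow_le_rpow_of_exponent_ge (sin_two_mul_pos hθ) (Real.sin_le_one _) h)

theorem angWt_le {η : ℝ} (hη : 0 ≤ η) {θ : ℝ} (hθ : θ ∈ Ioo 0 (π / 2)) :
    angWt η θ ≤ (2 / π * θ) ^ (-η) + (2 / π * (π / 2 - θ)) ^ (-η) := by
  have hp := Real.pi_pos
  have hx : 0 < 2 / π * θ := mul_pos (by positivity) hθ.1
  have hy : 0 < 2 / π * (π / 2 - θ) := mul_pos (by positivity) (by linarith [hθ.2])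
  have h := min_le_sin_two_mul hθ
  have hx' := Real.rpow_pos_of_pos hx (-η)
  have hy' := Real.rpow_pos_of_pos hy (-η)
  rw [angWt, ← Real.rpow_neg (sin_two_mul_pos hθ).le]
  rcases min_le_iff.1 h with h | h
  · linarith [Real.rpow_le_rpow_of_nonpos hx h (neg_nonpos.2 hη)]
  · linarith [Real.rpow_le_rpow_of_nonpos hy h (neg_nonpos.2 hη)]

theorem integral_rpow_scaled {η : ℝ} (hη : η < 1) :
    IntervalIntegrable (fun θ : ℝ => (2 / π * θ) ^ (-η)) volume 0 (π / 2) ∧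
      ∫ θ in (0 : ℝ)..π / 2, (2 / π * θ) ^ (-η) = π / 2 / (1 - η) := by
  have hp := Real.pi_pos
  have hc : 2 / π ≠ 0 := by positivity
  have h1 : 2 / π * (π / 2) = 1 := by field_simp
  constructor
  · have := (intervalIntegral.intervalIntegrable_rpow' (a := 0) (b := 1) (r := -η)
      (by linarith)).comp_mul_left (c := 2 / π)
    simpa using this
  · rw [intervalIntegral.integral_comp_mul_left (fun x : ℝ => x ^ (-η)) hc, mul_zero, h1,
      integral_rpow (Or.inl (by linarith)), Real.one_rpow, Real.zero_rpow (by linarith)]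
    have : (1 : ℝ) - η ≠ 0 := by linarith
    rw [neg_add_eq_sub]
    simp
    field_simp

theorem angWt_integrable_and_le {η : ℝ} (hη0 : 0 ≤ η) (hη : η < 1) :
    IntegrableOn (angWt η) (Icc 0 (π / 2)) ∧
      ∫ θ in Icc 0 (π / 2), angWt η θ ≤ π / (1 - η) := by
  have hp : (0 : ℝ) ≤ π / 2 := by positivity
  obtain ⟨hi, he⟩ := integral_rpow_scaled hη
  have hi' : IntervalIntegrable (fun θ : ℝ => (2 / π * (π / 2 - θ)) ^ (-η)) volume 0 (π / 2) := by
    simpa using (hi.comp_sub_left (π / 2)).symm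
  have he' : ∫ θ in (0 : ℝ)..π / 2, (2 / π * (π / 2 - θ)) ^ (-η) = π / 2 / (1 - η) := by
    rw [intervalIntegral.integral_comp_sub_left (fun θ : ℝ => (2 / π * θ) ^ (-η))]
    simpa using he
  have hs := hi.add hi'
  have hsO : IntegrableOn (fun θ : ℝ => (2 / π * θ) ^ (-η) + (2 / π * (π / 2 - θ)) ^ (-η))
      (Ioo 0 (π / 2)) := by
    rw [intervalIntegrable_iff_integrableOn_Ioo_of_le hp] at hs
    exact hs
  have hle : ∀ᵐ θ ∂volume.restrict (Ioo 0 (π / 2)),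
      angWt η θ ≤ (2 / π * θ) ^ (-η) + (2 / π * (π / 2 - θ)) ^ (-η) :=
    (ae_restrict_iff' measurableSet_Ioo).2 (Eventually.of_forall fun θ hθ => angWt_le hη0 hθ)
  have hI : IntegrableOn (angWt η) (Ioo 0 (π / 2)) := by
    refine Integrable.mono' hsO (measurable_angWt η).aestronglyMeasurable ?_
    filter_upwards [hle, ae_restrict_mem measurableSet_Ioo] with θ h hθ
    rwa [Real.norm_of_nonneg (angWt_nonneg η (Ioo_subset_Icc_self hθ))]
  refine ⟨(integrableOn_Icc_iff_integrableOn_Ioo (μ := volume)).2 hI, ?_⟩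
  rw [integral_Icc_eq_integral_Ioo]
  refine (integral_mono_ae hI hsO hle).trans (le_of_eq ?_)
  rw [← integral_Ioc_eq_integral_Ioo, ← intervalIntegral.integral_of_le hp,
    intervalIntegral.integral_add hi hi', he, he']
  ring

end AngularWeight

section IntegrationByParts

variable {a b : ℝ} {g : ℝ → ℝ → ℝ}

theorem continuousOn_wgt_fst (ha : 0 < a) (t : Set ℝ) :
    ContinuousOn (fun x : ℝ × ℝ => wgt x.1) (Icc a b ×ˢ t) := by
  unfold wgt
  refine ContinuousOn.div (by fun_prop) (by fun_prop) fun x hx => ?_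
  have : 0 < x.1 := ha.trans_le hx.1.1
  positivity

theorem hasDerivAt_wgt {z : ℝ} (hz : 0 < z) :
    HasDerivAt wgt (-2 * wgt z / (z * (1 + z))) z := by
  have h1 : HasDerivAt (fun x : ℝ => (1 + x) ^ 2) (2 * (1 + z)) z :=
    (((hasDerivAt_id' z).const_add 1).fun_pow 2).congr_deriv (by norm_num)
  have h2 : HasDerivAt (fun x : ℝ => x ^ 2) (2 * z) z :=
    (hasDerivAt_pow 2 z).congr_deriv (by norm_num)
  refine (h1.fun_div h2 (by positivity)).congr_deriv ?_
  unfold wgt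
  field_simp
  ring

theorem continuous_slice {g : ℝ → ℝ → ℝ} (hg : ContDiff ℝ (⊤ : ℕ∞) (Function.uncurry g)) :
    Continuous fun x : ℝ × ℝ => g x.1 x.2 :=
  hg.continuous

theorem integral_radial_parts {a₀ b₀ : ℝ} (ha : 0 < a) (haa : a < a₀) (hbb : b₀ < b)
    (hab : a ≤ b) (hg : ContDiff ℝ (⊤ : ℕ∞) (Function.uncurry g))
    (h0 : ∀ z θ : ℝ, z ∉ Icc a₀ b₀ → g z θ = 0) {s : ℝ → ℝ}
    (hs : IntegrableOn s (Icc 0 (π / 2))) :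
    Integrable (fun x : ℝ × ℝ => (Dzr g x.1 x.2 + 1 / 2 * g x.1 x.2 - 2 * g x.1 x.2 / (1 + x.1))
        * g x.1 x.2 * wgt x.1 ^ 2 * s x.2) (rectMeasure a b) ∧
      ∫ x : ℝ × ℝ, (Dzr g x.1 x.2 + 1 / 2 * g x.1 x.2 - 2 * g x.1 x.2 / (1 + x.1))
        * g x.1 x.2 * wgt x.1 ^ 2 * s x.2 ∂rectMeasure a b = 0 := by
  have hgc := continuous_slice hg
  have hDc := continuous_slice (contDiff_Dzr hg)
  have hcont : ContinuousOn (fun x : ℝ × ℝ => (Dzr g x.1 x.2 + 1 / 2 * g x.1 x.2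
      - 2 * g x.1 x.2 / (1 + x.1)) * g x.1 x.2 * wgt x.1 ^ 2) (Icc a b ×ˢ Icc 0 (π / 2)) := by
    have hw := continuousOn_wgt_fst (b := b) ha (Icc 0 (π / 2))
    have hdiv : ContinuousOn (fun x : ℝ × ℝ => 2 * g x.1 x.2 / (1 + x.1))
        (Icc a b ×ˢ Icc 0 (π / 2)) := by
      refine ContinuousOn.div (by fun_prop) (by fun_prop) fun x hx => ?_
      linarith [hx.1.1]
    exact (((hDc.continuousOn.add (hgc.continuousOn.const_mul _)).sub
      hdiv).mul hgc.continuousOn).mul (hw.pow 2)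
  have hint := integrable_mul_comp_snd hcont hs
  refine ⟨hint, ?_⟩
  rw [rectMeasure] at hint ⊢
  rw [integral_prod_symm _ hint]
  refine integral_eq_zero_of_ae ((ae_restrict_iff' measurableSet_Icc).2
    (Eventually.of_forall fun θ hθ => ?_))
  simp only [Pi.zero_apply]
  rw [integral_mul_const, integral_Icc_eq_integral_Ioc, ← intervalIntegral.integral_of_le hab]
  have hsl : ContinuousOn (fun z => (Dzr g z θ + 1 / 2 * g z θ - 2 * g z θ / (1 + z))
      * g z θ * wgt z ^ 2) (uIcc a b) := by
    rw [uIcc_of_le hab]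
    exact hcont.comp (by fun_prop : ContinuousOn (fun z : ℝ => (z, θ)) _) fun z hz => ⟨hz, hθ⟩
  rw [intervalIntegral.integral_eq_sub_of_hasDerivAt
    (f := fun z => 1 / 2 * (z * g z θ ^ 2 * wgt z ^ 2)) ?_ hsl.intervalIntegrable,
    h0 a θ (fun h => haa.not_ge h.1), h0 b θ (fun h => hbb.not_ge h.2)]
  · simp
  · intro z hz
    rw [uIcc_of_le hab] at hz
    have hz0 : 0 < z := ha.trans_le hz.1
    have h := ((((hasDerivAt_id' z).fun_mul ((hasDerivAt_fst hg z θ).fun_pow 2)).fun_mul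
      ((hasDerivAt_wgt hz0).fun_pow 2)).const_mul (1 / 2 : ℝ))
    refine h.congr_deriv ?_
    simp only [Dzr]
    field_simp
    ring

theorem integral_angular_slice {η : ℝ} (hη0 : 0 ≤ η) (hη : η < 1)
    (hg : ContDiff ℝ (⊤ : ℕ∞) (Function.uncurry g)) (z : ℝ) :
    ∫ θ in Icc 0 (π / 2), (Dth g z θ * g z θ + (1 - η) * Real.cos (2 * θ) * g z θ ^ 2)
      * angWt η θ = 0 := by
  have hp : (0 : ℝ) ≤ π / 2 := by positivity
  have hgc : Continuous fun θ => g z θ :=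
    continuous_iff_continuousAt.2 fun θ => (hasDerivAt_snd hg z θ).continuousAt
  have hDc : Continuous fun θ => Dth g z θ :=
    continuous_iff_continuousAt.2 fun θ => (hasDerivAt_snd (contDiff_Dth hg) z θ).continuousAt
  have hI : IntegrableOn (fun θ => (Dth g z θ * g z θ + (1 - η) * Real.cos (2 * θ) * g z θ ^ 2)
      * angWt η θ) (Icc 0 (π / 2)) := by
    refine (angWt_integrable_and_le hη0 hη).1.continuousOn_mul ?_ isCompact_Icc
    exact Continuous.continuousOn ((hDc.mul hgc).add
      ((continuous_const.mul (by fun_prop)).mul (hgc.pow 2)))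
  rw [integral_Icc_eq_integral_Ioc, ← intervalIntegral.integral_of_le hp,
    intervalIntegral.integral_eq_sub_of_hasDerivAt_of_le hp
    (f := fun θ => 1 / 2 * (g z θ ^ 2 * Real.sin (2 * θ) ^ (1 - η)))]
  · have : (1 : ℝ) - η ≠ 0 := by linarith
    have e : 2 * (π / 2) = π := by ring
    rw [e, Real.sin_pi, mul_zero, Real.sin_zero, Real.zero_rpow this]
    ring
  · have : ContinuousOn (fun θ : ℝ => Real.sin (2 * θ) ^ (1 - η)) (Icc 0 (π / 2)) :=
      ContinuousOn.rpow_const (by fun_prop) fun θ _ => Or.inr (by linarith)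
    exact ((hgc.continuousOn.pow 2).mul this).const_mul _
  · intro θ hθ
    have hs := sin_two_mul_pos hθ
    have h1 : HasDerivAt (fun θ : ℝ => Real.sin (2 * θ)) (Real.cos (2 * θ) * 2) θ := by
      simpa using ((hasDerivAt_id' θ).const_mul 2).sin
    have h2 := h1.rpow_const (p := 1 - η) (Or.inl hs.ne')
    have h := (((hasDerivAt_snd hg z θ).fun_pow 2).fun_mul h2).const_mul (1 / 2 : ℝ)
    refine h.congr_deriv ?_
    simp only [Dth, angWt]
    have e1 : Real.sin (2 * θ) ^ (1 - η) = Real.sin (2 * θ) * (Real.sin (2 * θ) ^ η)⁻¹ := by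
      rw [Real.rpow_sub hs, Real.rpow_one, div_eq_mul_inv]
    have e2 : Real.sin (2 * θ) ^ (1 - η - 1) = (Real.sin (2 * θ) ^ η)⁻¹ := by
      rw [← Real.rpow_neg hs.le]; congr 1; ring
    rw [e1, e2]
    ring
  · rw [intervalIntegrable_iff_integrableOn_Icc_of_le hp]
    exact hI

theorem integral_angular_parts {η : ℝ} (hη0 : 0 ≤ η) (hη : η < 1)
    (hg : ContDiff ℝ (⊤ : ℕ∞) (Function.uncurry g)) {c : ℝ → ℝ}
    (hc : ContinuousOn c (Icc a b)) :
    Integrable (fun x : ℝ × ℝ => c x.1 * (Dth g x.1 x.2 * g x.1 x.2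
        + (1 - η) * Real.cos (2 * x.2) * g x.1 x.2 ^ 2) * angWt η x.2) (rectMeasure a b) ∧
      ∫ x : ℝ × ℝ, c x.1 * (Dth g x.1 x.2 * g x.1 x.2
        + (1 - η) * Real.cos (2 * x.2) * g x.1 x.2 ^ 2) * angWt η x.2 ∂rectMeasure a b = 0 := by
  have hgc := continuous_slice hg
  have hDc := continuous_slice (contDiff_Dth hg)
  have hint := integrable_mul_comp_snd (a := a) (b := b) (φ := fun x : ℝ × ℝ =>
    c x.1 * (Dth g x.1 x.2 * g x.1 x.2 + (1 - η) * Real.cos (2 * x.2) * g x.1 x.2 ^ 2))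
    ((hc.comp continuousOn_fst fun x hx => hx.1).mul (Continuous.continuousOn (by fun_prop)))
    (angWt_integrable_and_le hη0 hη).1
  refine ⟨hint, ?_⟩
  rw [rectMeasure] at hint ⊢
  rw [integral_prod _ hint]
  refine integral_eq_zero_of_ae (Eventually.of_forall fun z => ?_)
  simp only [mul_assoc, Pi.zero_apply]
  rw [integral_const_mul]
  have := integral_angular_slice hη0 hη hg z
  simp only [mul_assoc] at this
  rw [this, mul_zero]

end IntegrationByParts

section AngularMoment

/-- The angular moment `∫_0^{π/2} f(z,θ) K(θ) dθ`. -/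
def angMoment (f : ℝ → ℝ → ℝ) (z : ℝ) : ℝ := ∫ θ in Icc 0 (π / 2), f z θ * Kker θ

variable {f : ℝ → ℝ → ℝ} {a b : ℝ}

theorem continuous_Kker : Continuous Kker := by
  unfold Kker; fun_prop

theorem continuous_angMoment (hf : Continuous (Function.uncurry f)) :
    Continuous (angMoment f) := by
  have hp : (0 : ℝ) ≤ π / 2 := by positivity
  have : angMoment f = fun z => ∫ θ in (0 : ℝ)..π / 2, f z θ * Kker θ := by
    ext z
    rw [angMoment, integral_Icc_eq_integral_Ioc, ← intervalIntegral.integral_of_le hp]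
  rw [this]
  refine intervalIntegral.continuous_parametric_intervalIntegral_of_continuous' ?_ _ _
  exact hf.mul (continuous_Kker.comp continuous_snd)

theorem angMoment_eq_zero (h0 : ∀ z θ : ℝ, z ∉ Icc a b → f z θ = 0) {z : ℝ}
    (hz : z ∉ Icc a b) : angMoment f z = 0 := by
  simp [angMoment, h0 z _ hz]

theorem Kker_sq_le (θ : ℝ) : Kker θ ^ 2 ≤ 9 := by
  have h1 := Real.sin_sq_le_one θ
  have h2 := Real.cos_sq_le_one θ
  have h3 : Kker θ ^ 2 = 9 * (Real.sin θ ^ 2 * (Real.cos θ ^ 2 * Real.cos θ ^ 2)) := by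
    unfold Kker; ring
  have h4 := mul_le_one₀ h2 (sq_nonneg (Real.cos θ)) h2
  have h5 := mul_le_one₀ h1 (mul_nonneg (sq_nonneg (Real.cos θ)) (sq_nonneg (Real.cos θ))) h4
  linarith

theorem sq_angMoment_le {z : ℝ} (hf : Continuous fun θ => f z θ) :
    angMoment f z ^ 2 ≤ 15 * ∫ θ in Icc 0 (π / 2), f z θ ^ 2 := by
  have hK := continuous_Kker
  have hi : ∀ {u : ℝ → ℝ}, Continuous u → Integrable u (volume.restrict (Icc 0 (π / 2))) :=
    fun hu => hu.continuousOn.integrableOn_compact isCompact_Icc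
  have hp : (0 : ℝ) ≤ π / 2 := by positivity
  have h1 := sq_integral_mul_le (hi (hf.pow 2)) (hi (hK.pow 2)) (hi (hf.mul hK))
  have h2 : ∫ θ in Icc 0 (π / 2), Kker θ ^ 2 ≤ ∫ _θ in Icc 0 (π / 2), (9 : ℝ) :=
    integral_mono (hi (hK.pow 2)) (hi continuous_const) fun θ => Kker_sq_le θ
  have h3 : ∫ _θ in Icc 0 (π / 2), (9 : ℝ) = π / 2 * 9 := by
    simp [hp]
  have h4 : 0 ≤ ∫ θ in Icc 0 (π / 2), f z θ ^ 2 := integral_nonneg fun _ => sq_nonneg _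
  have h5 := Real.pi_lt_d2
  calc angMoment f z ^ 2
      ≤ (∫ θ in Icc 0 (π / 2), f z θ ^ 2) * ∫ θ in Icc 0 (π / 2), Kker θ ^ 2 := h1
    _ ≤ (∫ θ in Icc 0 (π / 2), f z θ ^ 2) * 15 :=
        mul_le_mul_of_nonneg_left (by linarith) h4
    _ = _ := mul_comm _ _

theorem integral_sq_angMoment_le (ha : 0 < a) {η : ℝ} (hη0 : 0 ≤ η) (hη : η < 1)
    (hf : Continuous (Function.uncurry f)) :
    ∫ z in Icc a b, (angMoment f z * wgt z) ^ 2 ≤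
      15 * ∫ x : ℝ × ℝ, f x.1 x.2 ^ 2 * wgt x.1 ^ 2 * angWt η x.2 ∂rectMeasure a b := by
  have hfc : Continuous fun x : ℝ × ℝ => f x.1 x.2 := hf
  have hw := continuousOn_wgt_fst (b := b) ha (Icc 0 (π / 2))
  have hφ : ContinuousOn (fun x : ℝ × ℝ => f x.1 x.2 ^ 2 * wgt x.1 ^ 2)
      (Icc a b ×ˢ Icc 0 (π / 2)) := (hfc.continuousOn.pow 2).mul (hw.pow 2)
  have hs := integrable_mul_comp_snd hφ (angWt_integrable_and_le hη0 hη).1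
  have h1 := integrable_mul_comp_snd (s := fun _ => (1 : ℝ)) hφ
    (continuous_const.continuousOn.integrableOn_compact isCompact_Icc)
  simp only [mul_one] at h1
  have hwz : ContinuousOn wgt (Icc a b) := fun z hz =>
    (hasDerivAt_wgt (ha.trans_le hz.1)).continuousAt.continuousWithinAt
  have hle : ∫ x : ℝ × ℝ, f x.1 x.2 ^ 2 * wgt x.1 ^ 2 ∂rectMeasure a b ≤
      ∫ x : ℝ × ℝ, f x.1 x.2 ^ 2 * wgt x.1 ^ 2 * angWt η x.2 ∂rectMeasure a b := by
    refine integral_mono_ae h1 hs (ae_rectMeasure fun z _ θ hθ => ?_)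
    exact le_mul_of_one_le_right (by positivity) (one_le_angWt hη0 hθ)
  refine le_trans ?_ (mul_le_mul_of_nonneg_left hle (by norm_num))
  rw [rectMeasure] at h1 ⊢
  rw [integral_prod _ h1, ← integral_const_mul]
  refine integral_mono (((continuous_angMoment hf).continuousOn.mul hwz).pow 2
    |>.integrableOn_compact isCompact_Icc) (h1.integral_prod_left.const_mul 15) fun z => ?_
  simp only [integral_mul_const]
  have hz : Continuous fun θ => f z θ := hfc.comp (by fun_prop : Continuous fun θ : ℝ => (z, θ))
  rw [mul_pow, ← mul_assoc]
  exact mul_le_mul_of_nonneg_right (sq_angMoment_le hz) (sq_nonneg _)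

theorem integral_inv_one_add_sq_le (ha : 0 < a) (hab : a ≤ b) :
    ∫ z in Icc a b, 1 / (1 + z) ^ 2 ≤ 1 := by
  rw [integral_Icc_eq_integral_Ioc, ← intervalIntegral.integral_of_le hab,
    intervalIntegral.integral_eq_sub_of_hasDerivAt (f := fun z => -(1 / (1 + z)))]
  · have h1 : 1 / (1 + a) ≤ 1 := by
      rw [div_le_one (by linarith)]; linarith
    have h2 : 0 ≤ 1 / (1 + b) := by
      have : 0 < 1 + b := by linarith
      positivity
    linarith
  · intro z hz
    rw [uIcc_of_le hab] at hz
    have h : (1 : ℝ) + z ≠ 0 := by linarith [hz.1]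
    have := (((hasDerivAt_const z (1 : ℝ)).fun_div ((hasDerivAt_id' z).const_add 1) h)).fun_neg
    exact this.congr_deriv (by ring)
  · refine ContinuousOn.intervalIntegrable (ContinuousOn.div (by fun_prop) (by fun_prop) ?_)
    intro z hz
    rw [uIcc_of_le hab] at hz
    have : (1 : ℝ) + z ≠ 0 := by linarith [hz.1]
    positivity

theorem integral_inv_mul_wgt_sq_le (ha : 0 < a) (hab : a ≤ b) :
    ∫ z in Icc a b, (1 / (z * wgt z)) ^ 2 ≤ (b / (1 + b)) ^ 3 / 3 := by
  rw [integral_Icc_eq_integral_Ioc, ← intervalIntegral.integral_of_le hab,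
    intervalIntegral.integral_eq_sub_of_hasDerivAt (f := fun z => (z / (1 + z)) ^ 3 / 3)]
  · have h1 : 0 ≤ (a / (1 + a)) ^ 3 / 3 := by positivity
    linarith
  · intro z hz
    rw [uIcc_of_le hab] at hz
    have hz0 : 0 < z := ha.trans_le hz.1
    have h : (1 : ℝ) + z ≠ 0 := by linarith
    have := (((hasDerivAt_id' z).fun_div ((hasDerivAt_id' z).const_add 1) h).fun_pow 3).div_const 3
    refine this.congr_deriv ?_
    unfold wgt
    rw [div_pow]
    field_simp
    norm_num
    ring
  · refine ContinuousOn.intervalIntegrable (ContinuousOn.pow (ContinuousOn.div (by fun_prop) ?_ ?_) 2)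
    · rw [uIcc_of_le hab]
      exact continuousOn_id.mul fun z hz =>
        (hasDerivAt_wgt (ha.trans_le hz.1)).continuousAt.continuousWithinAt
    · intro z hz
      rw [uIcc_of_le hab] at hz
      have hz0 : 0 < z := ha.trans_le hz.1
      unfold wgt
      positivity

theorem sq_integral_div_le (ha : 0 < a) (hab : a ≤ b) {F : ℝ → ℝ}
    (hF : ContinuousOn F (Icc a b)) :
    (∫ r in Icc a b, F r / r) ^ 2 ≤
      (∫ r in Icc a b, (F r * wgt r) ^ 2) * ((b / (1 + b)) ^ 3 / 3) := by
  have hw : ContinuousOn wgt (Icc a b) := fun z hz =>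
    (hasDerivAt_wgt (ha.trans_le hz.1)).continuousAt.continuousWithinAt
  have hpos : ∀ r ∈ Icc a b, 0 < r ∧ 0 < wgt r := fun r hr => by
    have : 0 < r := ha.trans_le hr.1
    exact ⟨this, by unfold wgt; positivity⟩
  have hv : ContinuousOn (fun r => 1 / (r * wgt r)) (Icc a b) :=
    continuousOn_const.div (continuousOn_id.mul hw) fun r hr =>
      (mul_pos (hpos r hr).1 (hpos r hr).2).ne'
  have hi : ∀ {u : ℝ → ℝ}, ContinuousOn u (Icc a b) → Integrable u (volume.restrict (Icc a b)) :=
    fun hu => hu.integrableOn_compact isCompact_Icc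
  have h := sq_integral_mul_le (hi ((hF.mul hw).pow 2)) (hi (hv.pow 2)) (hi ((hF.mul hw).mul hv))
  have he : ∫ r in Icc a b, F r * wgt r * (1 / (r * wgt r)) = ∫ r in Icc a b, F r / r := by
    refine setIntegral_congr_fun measurableSet_Icc fun r hr => ?_
    have := hpos r hr
    have h1 := this.1.ne'
    have h2 := this.2.ne'
    field_simp
  rw [← he]
  exact h.trans (mul_le_mul_of_nonneg_left (integral_inv_mul_wgt_sq_le ha hab)
    (integral_nonneg fun _ => sq_nonneg _))

theorem L12_eq_integral (f : ℝ → ℝ → ℝ) (z : ℝ) :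
    L12 f z = ∫ r in Ioi z, angMoment f r / r := by
  simp only [L12, angMoment, integral_div]

theorem integrable_angMoment_div (ha : 0 < a) (hf : Continuous (Function.uncurry f))
    (h0 : ∀ z θ : ℝ, z ∉ Icc a b → f z θ = 0) :
    Integrable fun r => angMoment f r / r := by
  have h : IntegrableOn (fun r => angMoment f r / r) (Icc a b) :=
    ContinuousOn.integrableOn_compact isCompact_Icc
      ((continuous_angMoment hf).continuousOn.div continuousOn_id
        fun r hr => (ha.trans_le hr.1).ne')
  exact h.integrable_of_forall_notMem_eq_zero fun r hr => by simp [angMoment_eq_zero h0 hr]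

theorem L12_eq_neg_integral (ha : 0 < a) (hf : Continuous (Function.uncurry f))
    (h0 : ∀ z θ : ℝ, z ∉ Icc a b → f z θ = 0) (hL : L12 f 0 = 0) {z : ℝ} (hz : 0 ≤ z) :
    L12 f z = -∫ r in (0 : ℝ)..z, angMoment f r / r := by
  have hi := integrable_angMoment_div ha hf h0
  have h := intervalIntegral.integral_Ioi_sub_Ioi (μ := volume) (a := 0) (b := z)
    hi.integrableOn hz
  rw [← L12_eq_integral, ← L12_eq_integral, hL] at h
  linarith

theorem hasDerivAt_L12 (ha : 0 < a) (hf : Continuous (Function.uncurry f))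
    (h0 : ∀ z θ : ℝ, z ∉ Icc a b → f z θ = 0) (hL : L12 f 0 = 0) {z : ℝ} (hz : 0 < z) :
    HasDerivAt (L12 f) (-(angMoment f z / z)) z := by
  have hi := integrable_angMoment_div ha hf h0
  have h := intervalIntegral.integral_hasDerivAt_right (a := 0) (b := z)
    hi.intervalIntegrable hi.aestronglyMeasurable.stronglyMeasurableAtFilter
    ((continuous_angMoment hf).continuousAt.div continuousAt_id hz.ne')
  refine h.fun_neg.congr_of_eventuallyEq ?_
  filter_upwards [lt_mem_nhds hz] with y hy using L12_eq_neg_integral ha hf h0 hL hy.le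

theorem sq_L12_le (ha : 0 < a) (hf : Continuous (Function.uncurry f))
    (h0 : ∀ z θ : ℝ, z ∉ Icc a b → f z θ = 0) (hL : L12 f 0 = 0) {z : ℝ} (hz : z ∈ Icc a b) :
    L12 f z ^ 2 ≤ (∫ r in Icc a b, (angMoment f r * wgt r) ^ 2) * ((z / (1 + z)) ^ 3 / 3) := by
  have hc := continuous_angMoment hf
  have hz0 : 0 < z := ha.trans_le hz.1
  have hw : ContinuousOn wgt (Icc a b) := fun z hz =>
    (hasDerivAt_wgt (ha.trans_le hz.1)).continuousAt.continuousWithinAt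
  have h1 : L12 f z = -∫ r in Icc a z, angMoment f r / r := by
    rw [L12_eq_neg_integral ha hf h0 hL hz0.le, intervalIntegral.integral_of_le hz0.le,
      ← integral_Icc_eq_integral_Ioc]
    congr 1
    refine setIntegral_eq_of_subset_of_forall_sdiff_eq_zero measurableSet_Icc
      (Icc_subset_Icc_left ha.le) ?_
    rintro r ⟨hr, hr'⟩
    rw [angMoment_eq_zero h0 fun h => hr' ⟨h.1, hr.2⟩, zero_div]
  rw [h1, neg_sq]
  refine (sq_integral_div_le ha hz.1 hc.continuousOn).trans
    (mul_le_mul_of_nonneg_right ?_ (by positivity))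
  refine setIntegral_mono_set ?_ (Eventually.of_forall fun _ => sq_nonneg _)
    (Icc_subset_Icc_right hz.2).eventuallyLE
  exact ((hc.continuousOn.mul hw).pow 2).integrableOn_compact isCompact_Icc

theorem sq_L12_damped_le (ha : 0 < a) (hab : a ≤ b) (hf : Continuous (Function.uncurry f))
    (h0 : ∀ z θ : ℝ, z ∉ Icc a b → f z θ = 0) :
    L12 (fun z θ => 3 / (1 + z) * f z θ) 0 ^ 2 ≤
      3 * ∫ r in Icc a b, (angMoment f r * wgt r) ^ 2 := by
  have hc := continuous_angMoment hf
  have hw : ContinuousOn wgt (Icc a b) := fun z hz =>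
    (hasDerivAt_wgt (ha.trans_le hz.1)).continuousAt.continuousWithinAt
  have hm : ∀ r, angMoment (fun z θ => 3 / (1 + z) * f z θ) r = 3 / (1 + r) * angMoment f r := by
    intro r
    simp only [angMoment, mul_assoc, integral_const_mul]
  have h1 : L12 (fun z θ => 3 / (1 + z) * f z θ) 0 =
      ∫ r in Icc a b, (3 / (1 + r) * angMoment f r) / r := by
    rw [L12_eq_integral]
    simp only [hm]
    refine setIntegral_eq_of_subset_of_forall_sdiff_eq_zero measurableSet_Ioi
      (fun r hr => ha.trans_le hr.1) ?_
    rintro r ⟨-, hr⟩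
    simp [angMoment_eq_zero h0 hr]
  have hd : ContinuousOn (fun r : ℝ => 3 / (1 + r)) (Icc a b) :=
    continuousOn_const.div (by fun_prop) fun r hr => by linarith [hr.1]
  have hF : ContinuousOn (fun r => 3 / (1 + r) * angMoment f r) (Icc a b) :=
    hd.mul hc.continuousOn
  have h2 : ∫ r in Icc a b, (3 / (1 + r) * angMoment f r * wgt r) ^ 2 ≤
      9 * ∫ r in Icc a b, (angMoment f r * wgt r) ^ 2 := by
    rw [← integral_const_mul]
    refine setIntegral_mono_on (((hF.mul hw).pow 2).integrableOn_compact isCompact_Icc)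
      ((((hc.continuousOn.mul hw).pow 2).const_mul 9).integrableOn_compact isCompact_Icc)
      measurableSet_Icc fun r hr => ?_
    have hr0 : 0 < r := ha.trans_le hr.1
    have : (3 / (1 + r)) ^ 2 ≤ 9 := by
      rw [div_pow, div_le_iff₀ (by positivity)]
      nlinarith
    calc (3 / (1 + r) * angMoment f r * wgt r) ^ 2
        = (3 / (1 + r)) ^ 2 * (angMoment f r * wgt r) ^ 2 := by ring
      _ ≤ 9 * (angMoment f r * wgt r) ^ 2 := mul_le_mul_of_nonneg_right this (sq_nonneg _)
  have h3 : (b / (1 + b)) ^ 3 / 3 ≤ 1 / 3 := by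
    have hb : 0 < b := ha.trans_le hab
    have : b / (1 + b) ≤ 1 := by rw [div_le_one (by linarith)]; linarith
    have := pow_le_one₀ (n := 3) (by positivity) this
    linarith
  have h4 : 0 ≤ ∫ r in Icc a b, (3 / (1 + r) * angMoment f r * wgt r) ^ 2 :=
    integral_nonneg fun _ => sq_nonneg _
  rw [h1]
  have h5 := sq_integral_div_le ha hab hF
  have h6 := mul_le_mul_of_nonneg_left h3 h4
  linarith

end AngularMoment

section ProfileGamma

theorem sin_mul_cos_sq_mem {θ : ℝ} (hθ : θ ∈ Icc 0 (π / 2)) :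
    Real.sin θ * Real.cos θ ^ 2 ∈ Icc (0 : ℝ) 1 := by
  have h := Real.sin_nonneg_of_nonneg_of_le_pi hθ.1 (by linarith [hθ.2, Real.pi_pos])
  exact ⟨mul_nonneg h (sq_nonneg _),
    mul_le_one₀ (Real.sin_le_one _) (sq_nonneg _) (Real.cos_sq_le_one _)⟩

theorem Gam_mem {α : ℝ} (hα : 0 ≤ α) {θ : ℝ} (hθ : θ ∈ Icc 0 (π / 2)) :
    Gam α θ ∈ Icc (0 : ℝ) 1 := by
  obtain ⟨h0, h1⟩ := sin_mul_cos_sq_mem hθ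
  exact ⟨Real.rpow_nonneg h0 _, Real.rpow_le_one h0 h1 (by positivity)⟩

theorem continuous_Gam {α : ℝ} (hα : 0 ≤ α) : Continuous (Gam α) :=
  Continuous.rpow_const (by fun_prop) fun _ => Or.inr (by positivity)

theorem Kker_div_three_le_Gam {α : ℝ} (hα1 : α ≤ 3) {θ : ℝ}
    (hθ : θ ∈ Icc 0 (π / 2)) : Kker θ / 3 ≤ Gam α θ := by
  obtain ⟨h0, h1⟩ := sin_mul_cos_sq_mem hθ
  have hK : Kker θ / 3 = Real.sin θ * Real.cos θ ^ 2 := by unfold Kker; ring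
  rw [hK, Gam]
  rcases h0.eq_or_lt with h | h
  · rw [← h]; exact Real.rpow_nonneg le_rfl _
  · simpa using Real.rpow_le_rpow_of_exponent_ge h h1 (by linarith : α / 3 ≤ 1)

theorem integral_Kker : ∫ θ in Icc 0 (π / 2), Kker θ = 1 := by
  have hp : (0 : ℝ) ≤ π / 2 := by positivity
  rw [integral_Icc_eq_integral_Ioc, ← intervalIntegral.integral_of_le hp,
    intervalIntegral.integral_eq_sub_of_hasDerivAt (f := fun θ => -Real.cos θ ^ 3)]
  · simp
  · intro θ _
    refine ((Real.hasDerivAt_cos θ).fun_pow 3).fun_neg.congr_deriv ?_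
    unfold Kker
    norm_num
    ring
  · exact continuous_Kker.intervalIntegrable _ _

theorem le_cGam {α : ℝ} (hα : 0 < α) (hα1 : α ≤ 3) : 21 / 100 ≤ cGam α := by
  have hK := continuous_Kker
  have hi : ∀ {u : ℝ → ℝ}, Continuous u → Integrable u (volume.restrict (Icc 0 (π / 2))) :=
    fun hu => hu.continuousOn.integrableOn_compact isCompact_Icc
  have hp : (0 : ℝ) ≤ π / 2 := by positivity
  have h1 := sq_integral_mul_le (u := Kker) (v := fun _ => 1) (hi (hK.pow 2))
    (hi continuous_const) (hi (hK.mul continuous_const))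
  simp only [mul_one, integral_Kker] at h1
  have h2 : ∫ _θ in Icc 0 (π / 2), ((1 : ℝ) ^ 2) = π / 2 := by
    simp [hp]
  rw [h2] at h1
  have h3 : (∫ θ in Icc 0 (π / 2), Kker θ ^ 2) / 3 ≤ cGam α := by
    rw [cGam, ← integral_div]
    refine setIntegral_mono_on (hi ((hK.pow 2).div_const 3)) (hi ((continuous_Gam hα.le).mul hK))
      measurableSet_Icc fun θ hθ => ?_
    have hK0 : 0 ≤ Kker θ := by
      have := (sin_mul_cos_sq_mem hθ).1
      unfold Kker; linarith
    have := mul_le_mul_of_nonneg_right (Kker_div_three_le_Gam hα1 hθ) hK0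
    linarith
  have h4 := Real.pi_lt_d2
  have h5 := Real.pi_pos
  nlinarith

end ProfileGamma

section Coercivity

variable {f : ℝ → ℝ → ℝ} {a b : ℝ}

theorem Dzr_LGamT (α : ℝ) (ha : 0 < a) (hf : ContDiff ℝ (⊤ : ℕ∞) (Function.uncurry f))
    (h0 : ∀ z θ : ℝ, z ∉ Icc a b → f z θ = 0) (hL : L12 f 0 = 0) {z : ℝ} (hz : 0 < z) (θ : ℝ) :
    Dzr (LGamT α f) z θ = Dzr f z θ + Dzr (Dzr f) z θ - 2 * Dzr f z θ / (1 + z)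
      - 3 / (1 + z) * Dth (Dzr f) z θ + 2 * z / (1 + z) ^ 2 * f z θ
      + 3 * z / (1 + z) ^ 2 * Dth f z θ
      + Gam α θ / cGam α * (2 * z / (1 + z) ^ 2 * angMoment f z)
      - Gam α θ / cGam α * (2 * z * (1 - z) / (1 + z) ^ 3 * L12 f z)
      + Gam α θ / cGam α * (2 * z ^ 2 * (2 - z) / (1 + z) ^ 4
        * L12 (fun z2 θ2 => 3 / (1 + z2) * Dth f z2 θ2) 0) := by
  have hz1 : (1 : ℝ) + z ≠ 0 := by linarith
  have e : (fun s => LGamT α f s θ) = fun s => f s θ + Dzr f s θ - 2 * (f s θ / (1 + s))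
      - Gam α θ / cGam α * (2 * s / (1 + s) ^ 2 * L12 f s) - 3 * (Dth f s θ / (1 + s))
      + Gam α θ / cGam α * (2 * s ^ 2 / (1 + s) ^ 3
        * L12 (fun z2 θ2 => 3 / (1 + z2) * Dth f z2 θ2) 0) := by
    ext s
    simp only [LGamT, Pproj, LGam, Lop, Dzr, div_eq_mul_inv, mul_inv]
    ring
  have d1 : HasDerivAt (fun s : ℝ => 1 + s) 1 z := (hasDerivAt_id' z).const_add 1
  have df := hasDerivAt_fst hf z θ
  have dg := hasDerivAt_fst (contDiff_Dzr hf) z θ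
  have dh := hasDerivAt_fst (contDiff_Dth hf) z θ
  have dL := hasDerivAt_L12 ha hf.continuous h0 hL hz
  have d2 : HasDerivAt (fun s : ℝ => 2 * s / (1 + s) ^ 2) (2 * (1 - z) / (1 + z) ^ 3) z := by
    refine (((hasDerivAt_id' z).const_mul (2 : ℝ)).fun_div (d1.fun_pow 2)
      (pow_ne_zero 2 hz1)).congr_deriv ?_
    field_simp
    norm_num
    ring
  have d3 : HasDerivAt (fun s : ℝ => 2 * s ^ 2 / (1 + s) ^ 3)
      (2 * z * (2 - z) / (1 + z) ^ 4) z := by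
    refine (((hasDerivAt_pow 2 z).const_mul (2 : ℝ)).fun_div (d1.fun_pow 3)
      (pow_ne_zero 3 hz1)).congr_deriv ?_
    field_simp
    norm_num
    ring
  have h := ((((df.fun_add dg).fun_sub ((df.fun_div d1 hz1).const_mul 2)).fun_sub
    ((d2.fun_mul dL).const_mul (Gam α θ / cGam α))).fun_sub
    ((dh.fun_div d1 hz1).const_mul 3)).fun_add
    ((d3.mul_const (L12 (fun z2 θ2 => 3 / (1 + z2) * Dth f z2 θ2) 0)).const_mul
      (Gam α θ / cGam α))
  rw [← Dzr_Dth_comm hf]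
  have e0 : Dzr (LGamT α f) z θ = z * deriv (fun s => LGamT α f s θ) z := rfl
  have e1 : Dzr f z θ = z * deriv (fun s => f s θ) z := rfl
  have e2 : Dzr (Dzr f) z θ = z * deriv (fun s => Dzr f s θ) z := rfl
  have e3 : Dzr (Dth f) z θ = z * deriv (fun s => Dth f s θ) z := rfl
  rw [e0, e, h.deriv, e2, e3, e1]
  generalize Gam α θ / cGam α = G
  field_simp
  ring

theorem young_weighted {p g w s : ℝ} (hs : 0 ≤ s) :
    -(1 / 25 * (g ^ 2 * w ^ 2 * s)) - 25 / 4 * (p ^ 2 * w ^ 2 * s) ≤ p * (g * w ^ 2 * s) := by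
  nlinarith [mul_nonneg hs (sq_nonneg (g * w / 5 + 5 / 2 * (p * w)))]

theorem sq_radial_coeff_le {z : ℝ} (hz : 0 < z) : (z / (1 + z) ^ 2) ^ 2 ≤ 1 / 16 := by
  have q : z / (1 + z) ^ 2 ≤ 1 / 4 := by
    rw [div_le_div_iff₀ (by positivity) (by norm_num)]
    nlinarith [sq_nonneg (1 - z)]
  have q0 : 0 ≤ z / (1 + z) ^ 2 := by positivity
  nlinarith

theorem sq_L12_coeff_le {z Λ A : ℝ} (hz : 0 < z) (hA : 0 ≤ A)
    (hΛ : Λ ^ 2 ≤ A * ((z / (1 + z)) ^ 3 / 3)) :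
    (2 * z * (1 - z) / (1 + z) ^ 3 * Λ) ^ 2 * wgt z ^ 2 ≤ 4 / 3 * A * (1 / (1 + z) ^ 2) := by
  calc _ = (2 * (1 - z) / (z * (1 + z))) ^ 2 * Λ ^ 2 := by
        unfold wgt; field_simp
    _ ≤ (2 * (1 - z) / (z * (1 + z))) ^ 2 * (A * ((z / (1 + z)) ^ 3 / 3)) :=
        mul_le_mul_of_nonneg_left hΛ (sq_nonneg _)
    _ = 4 / 3 * A * ((1 - z) ^ 2 * z / (1 + z) ^ 5) := by
        rw [div_pow, div_pow]; field_simp; ring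
    _ ≤ 4 / 3 * A * (1 / (1 + z) ^ 2) := by
        refine mul_le_mul_of_nonneg_left ?_ (by positivity)
        rw [div_le_div_iff₀ (by positivity) (by positivity)]
        have : (1 - z) ^ 2 * z ≤ (1 + z) ^ 3 := by nlinarith [sq_nonneg z, pow_pos hz 3]
        calc _ ≤ (1 + z) ^ 3 * (1 + z) ^ 2 := mul_le_mul_of_nonneg_right this (by positivity)
          _ = _ := by ring

theorem sq_projection_coeff_le {z : ℝ} (l : ℝ) (hz : 0 < z) :
    (2 * z ^ 2 * (2 - z) / (1 + z) ^ 4 * l) ^ 2 * wgt z ^ 2 ≤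
      16 * l ^ 2 * (1 / (1 + z) ^ 2) := by
  calc _ = 4 * l ^ 2 * ((2 - z) ^ 2 / (1 + z) ^ 4) := by
        unfold wgt; field_simp; ring
    _ ≤ 4 * l ^ 2 * (4 * (1 / (1 + z) ^ 2)) := by
        refine mul_le_mul_of_nonneg_left ?_ (by positivity)
        rw [mul_one_div, div_le_div_iff₀ (by positivity) (by positivity)]
        have : (2 - z) ^ 2 ≤ 4 * (1 + z) ^ 2 := by nlinarith
        calc _ ≤ 4 * (1 + z) ^ 2 * (1 + z) ^ 2 :=
              mul_le_mul_of_nonneg_right this (by positivity)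
          _ = _ := by ring
    _ = _ := by ring

theorem transport_lower_bound {r C N : ℝ} (hr0 : 0 ≤ r) (hr : r ≤ 3) (hC : |C| ≤ 1)
    (hN : 0 ≤ N) : -(3 / 100 * N) ≤ r * ((1 - 99 / 100) * C * N) := by
  have hC' : -3 ≤ r * C := by nlinarith [(abs_le.1 hC).1]
  have := mul_le_mul_of_nonneg_right hC' hN
  linarith

theorem sq_mul_weight_le {G P w M s : ℝ} (hs : 0 ≤ s) (hG : G ^ 2 ≤ 23)
    (hP : P ^ 2 * w ^ 2 ≤ M) : (G * P) ^ 2 * w ^ 2 * s ≤ 23 * (M * s) := by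
  calc _ = G ^ 2 * (P ^ 2 * w ^ 2 * s) := by ring
    _ ≤ 23 * (P ^ 2 * w ^ 2 * s) := mul_le_mul_of_nonneg_right hG (by positivity)
    _ ≤ 23 * (M * s) := by
      have := mul_le_mul_of_nonneg_right hP hs
      linarith

theorem coercive_combine {g p D r k C w s P₁ P₂ P₃ P₄ P₅ : ℝ} (hs : 0 ≤ s) (hr0 : 0 ≤ r)
    (hr : r ≤ 3) (hC : |C| ≤ 1) :
    (p + 1 / 2 * g - D) * g * w ^ 2 * s
      + (-r * w ^ 2) * (k * g + (1 - 99 / 100) * C * g ^ 2) * s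
      + 1 / 4 * (g ^ 2 * w ^ 2 * s) - 25 / 4 * (P₁ ^ 2 * w ^ 2 * s + P₂ ^ 2 * w ^ 2 * s
        + P₃ ^ 2 * w ^ 2 * s + P₄ ^ 2 * w ^ 2 * s + P₅ ^ 2 * w ^ 2 * s)
    ≤ (g + p - D - r * k + P₁ + P₂ + P₃ - P₄ + P₅) * (g * w ^ 2 * s) := by
  have y1 := young_weighted (p := P₁) (g := g) (w := w) hs
  have y2 := young_weighted (p := P₂) (g := g) (w := w) hs
  have y3 := young_weighted (p := P₃) (g := g) (w := w) hs
  have y4 := young_weighted (p := -P₄) (g := g) (w := w) hs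
  have y5 := young_weighted (p := P₅) (g := g) (w := w) hs
  have hg : 0 ≤ g ^ 2 * w ^ 2 * s := by positivity
  have h6 := transport_lower_bound hr0 hr hC hg
  linarith

theorem coercive_pointwise {z f g p k h F Λ l A G C s t : ℝ} (hz : 0 < z) (hs : 0 ≤ s)
    (hst : s ≤ t) (hC : |C| ≤ 1) (hG : G ^ 2 ≤ 23)
    (hΛ : Λ ^ 2 ≤ A * ((z / (1 + z)) ^ 3 / 3)) (hA : 0 ≤ A) :
    (p + 1 / 2 * g - 2 * g / (1 + z)) * g * wgt z ^ 2 * s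
      + (-(3 / (1 + z)) * wgt z ^ 2) * (k * g + (1 - 99 / 100) * C * g ^ 2) * s
      + 1 / 4 * (g ^ 2 * wgt z ^ 2 * s) - 25 / 16 * (f ^ 2 * wgt z ^ 2 * s)
      - 225 / 64 * (h ^ 2 * wgt z ^ 2 * t)
      - 575 / 4 * ((1 / 4 * (F * wgt z) ^ 2 + (4 / 3 * A + 16 * l ^ 2) * (1 / (1 + z) ^ 2)) * s)
    ≤ (g + p - 2 * g / (1 + z) - 3 / (1 + z) * k + 2 * z / (1 + z) ^ 2 * f
      + 3 * z / (1 + z) ^ 2 * h + G * (2 * z / (1 + z) ^ 2 * F)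
      - G * (2 * z * (1 - z) / (1 + z) ^ 3 * Λ)
      + G * (2 * z ^ 2 * (2 - z) / (1 + z) ^ 4 * l)) * (g * wgt z ^ 2 * s) := by
  have hz1 : (0 : ℝ) < 1 + z := by linarith
  have q2 := sq_radial_coeff_le hz
  have b1 : (2 * z / (1 + z) ^ 2 * f) ^ 2 * wgt z ^ 2 * s ≤ 1 / 4 * (f ^ 2 * wgt z ^ 2 * s) := by
    have := mul_le_mul_of_nonneg_right q2 (by positivity : 0 ≤ f ^ 2 * wgt z ^ 2 * s)
    calc _ = 4 * ((z / (1 + z) ^ 2) ^ 2 * (f ^ 2 * wgt z ^ 2 * s)) := by ring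
      _ ≤ _ := by linarith
  have b2 : (3 * z / (1 + z) ^ 2 * h) ^ 2 * wgt z ^ 2 * s ≤
      9 / 16 * (h ^ 2 * wgt z ^ 2 * t) := by
    have h1 := mul_le_mul_of_nonneg_right q2 (by positivity : 0 ≤ h ^ 2 * wgt z ^ 2 * s)
    have h2 := mul_le_mul_of_nonneg_left hst (by positivity : 0 ≤ h ^ 2 * wgt z ^ 2)
    calc _ = 9 * ((z / (1 + z) ^ 2) ^ 2 * (h ^ 2 * wgt z ^ 2 * s)) := by ring
      _ ≤ 9 * (1 / 16 * (h ^ 2 * wgt z ^ 2 * s)) := by linarith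
      _ ≤ _ := by linarith
  have b3 := sq_mul_weight_le (w := wgt z) (P := 2 * z / (1 + z) ^ 2 * F)
    (M := 1 / 4 * (F * wgt z) ^ 2)
    hs hG (by
      have := mul_le_mul_of_nonneg_right q2 (sq_nonneg (F * wgt z))
      calc _ = 4 * ((z / (1 + z) ^ 2) ^ 2 * (F * wgt z) ^ 2) := by ring
        _ ≤ _ := by linarith)
  have b4 := sq_mul_weight_le hs hG (sq_L12_coeff_le hz hA hΛ)
  have b5 := sq_mul_weight_le hs hG (sq_projection_coeff_le l hz)
  have hr : 3 / (1 + z) ≤ 3 := by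
    rw [div_le_iff₀ hz1]; linarith
  refine le_trans ?_ (coercive_combine hs (by positivity) hr hC)
  have e : (1 / 4 * (F * wgt z) ^ 2 + (4 / 3 * A + 16 * l ^ 2) * (1 / (1 + z) ^ 2)) * s =
      1 / 4 * (F * wgt z) ^ 2 * s + 4 / 3 * A * (1 / (1 + z) ^ 2) * s
        + 16 * l ^ 2 * (1 / (1 + z) ^ 2) * s := by ring
  rw [e, sub_sub, sub_sub]
  refine sub_le_sub_left ?_ _
  generalize 1 / 4 * (F * wgt z) ^ 2 * s = x₁ at *
  generalize 4 / 3 * A * (1 / (1 + z) ^ 2) * s = x₂ at *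
  generalize 16 * l ^ 2 * (1 / (1 + z) ^ 2) * s = x₃ at *
  generalize f ^ 2 * wgt z ^ 2 * s = x₄ at *
  generalize h ^ 2 * wgt z ^ 2 * t = x₅ at *
  linarith

theorem ip_weighted_sq (ha : 0 < a) {u : ℝ → ℝ → ℝ} (h0 : ∀ z θ : ℝ, z ∉ Icc a b → u z θ = 0)
    {β : ℝ} (hint : Integrable (fun x : ℝ × ℝ => u x.1 x.2 ^ 2 * wgt x.1 ^ 2 * angWt β x.2)
      (rectMeasure a b)) :
    ip (fun z θ => u z θ * wgt z / Real.sin (2 * θ) ^ (β / 2))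
        (fun z θ => u z θ * wgt z / Real.sin (2 * θ) ^ (β / 2)) =
      ∫ x : ℝ × ℝ, u x.1 x.2 ^ 2 * wgt x.1 ^ 2 * angWt β x.2 ∂rectMeasure a b := by
  have he : ∀ᵐ x ∂rectMeasure a b, u x.1 x.2 ^ 2 * wgt x.1 ^ 2 * angWt β x.2 =
      u x.1 x.2 * wgt x.1 / Real.sin (2 * x.2) ^ (β / 2) *
        (u x.1 x.2 * wgt x.1 / Real.sin (2 * x.2) ^ (β / 2)) := by
    refine ae_rectMeasure fun z _ θ hθ => ?_
    have : Real.sin (2 * θ) ^ β = Real.sin (2 * θ) ^ (β / 2) * Real.sin (2 * θ) ^ (β / 2) := by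
      rw [← Real.rpow_add (sin_two_mul_pos hθ), add_halves]
    simp only [angWt, this, mul_inv]
    ring
  rw [integral_congr_ae he]
  exact ip_eq_integral_rectMeasure ha (fun z θ hz => by simp [h0 z θ hz]) (hint.congr he)

theorem integrableOn_sin_sq_mul_angWt {γ : ℝ} (hγ : γ ≤ 2) :
    IntegrableOn (fun θ => Real.sin (2 * θ) ^ 2 * angWt γ θ) (Icc 0 (π / 2)) := by
  rw [integrableOn_Icc_iff_integrableOn_Ioo]
  have h1 : IntegrableOn (fun _ : ℝ => (1 : ℝ)) (Ioo 0 (π / 2)) :=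
    integrableOn_const (by simp)
  refine Integrable.mono' h1
    (Measurable.aestronglyMeasurable (by have := measurable_angWt γ; fun_prop)) ?_
  filter_upwards [ae_restrict_mem measurableSet_Ioo] with θ hθ
  have hs := sin_two_mul_pos hθ
  have hr := Real.rpow_pos_of_pos hs γ
  rw [Real.norm_of_nonneg (mul_nonneg (sq_nonneg _) (angWt_nonneg γ (Ioo_subset_Icc_self hθ))),
    angWt, ← div_eq_mul_inv, div_le_one hr, ← Real.rpow_two]
  exact Real.rpow_le_rpow_of_exponent_ge hs (Real.sin_le_one _) hγ

theorem integrable_sq_mul_angWt (ha : 0 < a) {u : ℝ → ℝ → ℝ}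
    (hu : Continuous (Function.uncurry u)) {η : ℝ} (hη0 : 0 ≤ η) (hη : η < 1) :
    Integrable (fun x : ℝ × ℝ => u x.1 x.2 ^ 2 * wgt x.1 ^ 2 * angWt η x.2)
      (rectMeasure a b) := by
  have huc : Continuous fun x : ℝ × ℝ => u x.1 x.2 := hu
  exact integrable_mul_comp_snd ((huc.continuousOn.pow 2).mul
    ((continuousOn_wgt_fst ha _).pow 2)) (angWt_integrable_and_le hη0 hη).1

theorem integrable_Dth_sq_mul_angWt (ha : 0 < a)
    (hf : ContDiff ℝ (⊤ : ℕ∞) (Function.uncurry f)) {γ : ℝ} (hγ : γ ≤ 2) :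
    Integrable (fun x : ℝ × ℝ => Dth f x.1 x.2 ^ 2 * wgt x.1 ^ 2 * angWt γ x.2)
      (rectMeasure a b) := by
  have hd := continuous_slice (contDiff_deriv_snd hf)
  have := integrable_mul_comp_snd (a := a) (b := b) ((hd.continuousOn.pow 2).mul
    ((continuousOn_wgt_fst ha _).pow 2)) (integrableOn_sin_sq_mul_angWt hγ)
  refine this.congr (Eventually.of_forall fun x => ?_)
  simp only [Dth, Pi.mul_apply, Pi.pow_apply]
  ring

theorem integrable_Dzr_LGamT_mul {α : ℝ} (hα : 0 ≤ α) (ha : 0 < a)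
    (hf : ContDiff ℝ (⊤ : ℕ∞) (Function.uncurry f))
    (h0 : ∀ z θ : ℝ, z ∉ Icc a b → f z θ = 0) (hL : L12 f 0 = 0) {η : ℝ} (hη0 : 0 ≤ η)
    (hη : η < 1) :
    Integrable (fun x : ℝ × ℝ => Dzr (LGamT α f) x.1 x.2 *
      (Dzr f x.1 x.2 * wgt x.1 ^ 2 * angWt η x.2)) (rectMeasure a b) := by
  have hg := contDiff_Dzr hf
  have cf := continuous_slice hf
  have cg := continuous_slice hg
  have cp := continuous_slice (contDiff_Dzr hg)
  have ch := continuous_slice (contDiff_Dth hf)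
  have ck := continuous_slice (contDiff_Dth hg)
  have cF : Continuous fun x : ℝ × ℝ => angMoment f x.1 :=
    (continuous_angMoment hf.continuous).comp continuous_fst
  have cG : Continuous fun x : ℝ × ℝ => Gam α x.2 := (continuous_Gam hα).comp continuous_snd
  have cw := continuousOn_wgt_fst (b := b) ha (Icc 0 (π / 2))
  have cL : ContinuousOn (fun x : ℝ × ℝ => L12 f x.1) (Icc a b ×ˢ Icc 0 (π / 2)) :=
    ContinuousOn.comp (t := Icc a b) (fun z hz => (hasDerivAt_L12 ha hf.continuous h0 hL
      (ha.trans_le hz.1)).continuousAt.continuousWithinAt) continuousOn_fst fun x hx => hx.1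
  have ci : ContinuousOn (fun x : ℝ × ℝ => (1 + x.1)⁻¹) (Icc a b ×ˢ Icc 0 (π / 2)) :=
    ContinuousOn.inv₀ (by fun_prop) fun x hx => by linarith [hx.1.1]
  have cX : ContinuousOn (fun x : ℝ × ℝ => Dzr (LGamT α f) x.1 x.2)
      (Icc a b ×ˢ Icc 0 (π / 2)) := by
    refine ContinuousOn.congr ?_ fun x hx =>
      Dzr_LGamT α ha hf h0 hL (ha.trans_le hx.1.1) x.2
    have key {S : Set (ℝ × ℝ)} {f g p h k F G L i : ℝ × ℝ → ℝ} {c l : ℝ} (cf : ContinuousOn f S)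
        (cg : ContinuousOn g S) (cp : ContinuousOn p S) (ch : ContinuousOn h S)
        (ck : ContinuousOn k S) (cF : ContinuousOn F S) (cG : ContinuousOn G S)
        (cL : ContinuousOn L S) (ci : ContinuousOn i S) :
        ContinuousOn (fun x => g x + p x - 2 * g x * i x - 3 * i x * k x +
          2 * x.1 * i x ^ 2 * f x + 3 * x.1 * i x ^ 2 * h x +
          G x * c * (2 * x.1 * i x ^ 2 * F x) -
          G x * c * (2 * x.1 * (1 - x.1) * i x ^ 3 * L x) +
          G x * c * (2 * x.1 ^ 2 * (2 - x.1) * i x ^ 4 * l)) S := by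
      fun_prop
    refine (key (c := (cGam α)⁻¹) (l := L12 (fun z θ => 3 / (1 + z) * Dth f z θ) 0)
      cf.continuousOn cg.continuousOn cp.continuousOn ch.continuousOn ck.continuousOn
      cF.continuousOn cG.continuousOn cL ci).congr fun x _ => ?_
    simp only [div_eq_mul_inv, inv_pow]
  refine (integrable_mul_comp_snd (cX.mul (cg.continuousOn.mul (cw.pow 2)))
    (angWt_integrable_and_le hη0 hη).1).congr (Eventually.of_forall fun x => ?_)
  simp only [Pi.mul_apply, Pi.pow_apply, mul_assoc]

theorem integral_mul_angWt_le (ha : 0 < a) (hab : a ≤ b) {η : ℝ} (hη0 : 0 ≤ η) (hη : η < 1)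
    {F : ℝ → ℝ} (hF : ContinuousOn F (Icc a b)) {B : ℝ} (hB : 0 ≤ B) :
    Integrable (fun x : ℝ × ℝ => (1 / 4 * (F x.1 * wgt x.1) ^ 2 + B * (1 / (1 + x.1) ^ 2))
        * angWt η x.2) (rectMeasure a b) ∧
      ∫ x : ℝ × ℝ, (1 / 4 * (F x.1 * wgt x.1) ^ 2 + B * (1 / (1 + x.1) ^ 2))
        * angWt η x.2 ∂rectMeasure a b ≤
      (1 / 4 * (∫ z in Icc a b, (F z * wgt z) ^ 2) + B) * (π / (1 - η)) := by
  have hw : ContinuousOn wgt (Icc a b) := fun z hz =>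
    (hasDerivAt_wgt (ha.trans_le hz.1)).continuousAt.continuousWithinAt
  have c1 : ContinuousOn (fun z => (F z * wgt z) ^ 2) (Icc a b) := (hF.mul hw).pow 2
  have c2 : ContinuousOn (fun z : ℝ => 1 / (1 + z) ^ 2) (Icc a b) :=
    continuousOn_const.div (by fun_prop) fun z hz => by
      have : 0 < z := ha.trans_le hz.1
      positivity
  have i1 : IntegrableOn (fun z => (F z * wgt z) ^ 2) (Icc a b) :=
    c1.integrableOn_compact isCompact_Icc
  have i2 : IntegrableOn (fun z : ℝ => 1 / (1 + z) ^ 2) (Icc a b) :=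
    c2.integrableOn_compact isCompact_Icc
  obtain ⟨hs, hsle⟩ := angWt_integrable_and_le hη0 hη
  have hs0 : 0 ≤ ∫ θ in Icc 0 (π / 2), angWt η θ :=
    setIntegral_nonneg measurableSet_Icc fun θ hθ => angWt_nonneg η hθ
  have hN := (i1.const_mul (1 / 4)).add (i2.const_mul B)
  refine ⟨hN.mul_prod hs, ?_⟩
  rw [rectMeasure, integral_prod_mul (fun z => 1 / 4 * (F z * wgt z) ^ 2 + B * (1 / (1 + z) ^ 2))
    (angWt η), integral_add (i1.const_mul _) (i2.const_mul _), integral_const_mul,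
    integral_const_mul]
  have hA : 0 ≤ ∫ z in Icc a b, (F z * wgt z) ^ 2 := integral_nonneg fun _ => sq_nonneg _
  refine mul_le_mul ?_ hsle hs0 (by positivity)
  have := mul_le_mul_of_nonneg_left (integral_inv_one_add_sq_le ha hab) hB
  linarith

theorem coercive_rect {α : ℝ} (hα : 0 < α) (hα3 : α ≤ 3) {γ : ℝ} (hγ1 : 99 / 100 ≤ γ)
    (hγ2 : γ ≤ 2) {a₀ b₀ : ℝ} (ha : 0 < a) (haa : a < a₀) (hbb : b₀ < b) (hab : a ≤ b)
    (hf : ContDiff ℝ (⊤ : ℕ∞) (Function.uncurry f))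
    (h0 : ∀ z θ : ℝ, z ∉ Icc a₀ b₀ → f z θ = 0) (hL : L12 f 0 = 0) :
    1 / 4 * (∫ x : ℝ × ℝ, Dzr f x.1 x.2 ^ 2 * wgt x.1 ^ 2 * angWt (99 / 100) x.2
        ∂rectMeasure a b)
      - 10 ^ 8 * ((∫ x : ℝ × ℝ, Dth f x.1 x.2 ^ 2 * wgt x.1 ^ 2 * angWt γ x.2 ∂rectMeasure a b)
        + ∫ x : ℝ × ℝ, f x.1 x.2 ^ 2 * wgt x.1 ^ 2 * angWt (99 / 100) x.2 ∂rectMeasure a b) ≤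
    ∫ x : ℝ × ℝ, Dzr (LGamT α f) x.1 x.2 *
      (Dzr f x.1 x.2 * wgt x.1 ^ 2 * angWt (99 / 100) x.2) ∂rectMeasure a b := by
  have hη0 : (0 : ℝ) ≤ 99 / 100 := by norm_num
  have hη : (99 / 100 : ℝ) < 1 := by norm_num
  have hsub : Icc a₀ b₀ ⊆ Icc a b := Icc_subset_Icc haa.le hbb.le
  have h0' : ∀ z θ : ℝ, z ∉ Icc a b → f z θ = 0 := fun z θ hz => h0 z θ fun h => hz (hsub h)
  have hg := contDiff_Dzr hf
  have hh := contDiff_Dth hf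
  set A := ∫ r in Icc a b, (angMoment f r * wgt r) ^ 2 with hAdef
  set l := L12 (fun z2 θ2 => 3 / (1 + z2) * Dth f z2 θ2) 0 with hl
  have hA0 : 0 ≤ A := integral_nonneg fun _ => sq_nonneg _
  obtain ⟨i1, e1⟩ := integral_radial_parts ha haa hbb hab hg (Dzr_eq_zero h0)
    (angWt_integrable_and_le hη0 hη).1
  have hc : ContinuousOn (fun z => -(3 / (1 + z)) * wgt z ^ 2) (Icc a b) := by
    refine ContinuousOn.mul (continuousOn_const.div (by fun_prop) fun z hz => ?_).neg
      (ContinuousOn.pow (fun z hz =>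
        (hasDerivAt_wgt (ha.trans_le hz.1)).continuousAt.continuousWithinAt) 2)
    linarith [hz.1]
  obtain ⟨i2, e2⟩ := integral_angular_parts hη0 hη hg hc
  have i3 := integrable_sq_mul_angWt (b := b) ha hg.continuous hη0 hη
  have i4 := integrable_sq_mul_angWt (b := b) ha hf.continuous hη0 hη
  have i5 := integrable_Dth_sq_mul_angWt (b := b) ha hf hγ2
  have i5' := integrable_sq_mul_angWt (b := b) ha hh.continuous hη0 hη
  obtain ⟨i6, e6⟩ := integral_mul_angWt_le ha hab hη0 hη
    (continuous_angMoment hf.continuous).continuousOn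
    (by positivity : 0 ≤ 4 / 3 * A + 16 * l ^ 2)
  have iX := integrable_Dzr_LGamT_mul hα.le ha hf h0' hL hη0 hη
  have hc0 := le_cGam hα hα3
  have hmono := integral_mono_ae (((((i1.add i2).add (i3.const_mul (1 / 4))).sub
    (i4.const_mul (25 / 16))).sub (i5.const_mul (225 / 64))).sub (i6.const_mul (575 / 4))) iX
    (ae_rectMeasure fun z hz θ hθ => by
      have hz0 : 0 < z := ha.trans_le hz.1
      have hθ' := Ioo_subset_Icc_self hθ
      have hG : (Gam α θ / cGam α) ^ 2 ≤ 23 := by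
        obtain ⟨hG0, hG1⟩ := Gam_mem hα.le hθ'
        rw [div_pow, div_le_iff₀ (by positivity)]
        nlinarith
      have := coercive_pointwise (f := f z θ) (g := Dzr f z θ) (p := Dzr (Dzr f) z θ)
        (k := Dth (Dzr f) z θ) (h := Dth f z θ) (F := angMoment f z) (l := l) hz0
        (angWt_nonneg (99 / 100) hθ') (angWt_mono hγ1 hθ) (Real.abs_cos_le_one (2 * θ)) hG
        (sq_L12_le ha hf.continuous h0' hL hz) hA0
      rw [hl, ← Dzr_LGamT α ha hf h0' hL hz0 θ] at this
      exact this)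
  rw [integral_sub' ((((i1.add i2).add (i3.const_mul _)).sub (i4.const_mul _)).sub
      (i5.const_mul _)) (i6.const_mul _),
    integral_sub' (((i1.add i2).add (i3.const_mul _)).sub (i4.const_mul _)) (i5.const_mul _),
    integral_sub' ((i1.add i2).add (i3.const_mul _)) (i4.const_mul _),
    integral_add' (i1.add i2) (i3.const_mul _), integral_add' i1 i2, e1, e2, integral_const_mul,
    integral_const_mul, integral_const_mul, integral_const_mul] at hmono
  have bA : A ≤ _ := integral_sq_angMoment_le ha hη0 hη hf.continuous
  have bl : l ^ 2 ≤ _ := sq_L12_damped_le ha hab hh.continuous (Dth_eq_zero h0')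
  have bB := integral_sq_angMoment_le (b := b) ha hη0 hη hh.continuous
  have bH := integral_mono_ae i5' i5 (ae_rectMeasure fun z _ θ hθ =>
    mul_le_mul_of_nonneg_left (angWt_mono hγ1 hθ) (by positivity))
  have hE : 0 ≤ ∫ x : ℝ × ℝ, f x.1 x.2 ^ 2 * wgt x.1 ^ 2 * angWt (99 / 100) x.2
      ∂rectMeasure a b := integral_nonneg_of_ae (ae_rectMeasure fun z _ θ hθ =>
    mul_nonneg (by positivity) (angWt_nonneg _ (Ioo_subset_Icc_self hθ)))
  have hH : 0 ≤ ∫ x : ℝ × ℝ, Dth f x.1 x.2 ^ 2 * wgt x.1 ^ 2 * angWt γ x.2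
      ∂rectMeasure a b := integral_nonneg_of_ae (ae_rectMeasure fun z _ θ hθ =>
    mul_nonneg (by positivity) (angWt_nonneg _ (Ioo_subset_Icc_self hθ)))
  have hpi : π / (1 - 99 / 100) ≤ 315 := by
    have := Real.pi_lt_d2
    rw [div_le_iff₀ (by norm_num)]
    linarith
  have hl0 := sq_nonneg l
  have h6 := mul_le_mul_of_nonneg_left hpi
    (by positivity : 0 ≤ 1 / 4 * A + (4 / 3 * A + 16 * l ^ 2))
  linarith

end Coercivity

/-- Coercivity of `𝓛_Γ^T` with one radial derivative: for `0 < α < 10⁻¹⁴`, `η = 99/100`,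
`γ = 1 + α/10`, and every admissible `f` with `L₁₂(f)(0) = 0`,
`(D_z(𝓛_Γ^T(f)), (D_z f)·w²/sin(2θ)^η) ≥ (1/4)‖(D_z f)·w/sin(2θ)^{η/2}‖² − 10⁸ E_θ¹(f)`,
where `E_θ¹(f) = ‖(D_θ f)·w/sin(2θ)^{γ/2}‖² + ‖f·w/sin(2θ)^{η/2}‖²`. -/
theorem LGamT_coercive_z (α : ℝ) (hα : 0 < α) (hα' : α < 1 / 10 ^ 14)
    (η γ : ℝ) (hη : η = 99 / 100) (hγ : γ = 1 + α / 10)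
    (f : ℝ → ℝ → ℝ) (hf : Admissible f) (hf0 : L12 f 0 = 0) :
    ip (Dzr (LGamT α f))
        (fun z θ => Dzr f z θ * wgt z ^ 2 / Real.sin (2 * θ) ^ η) ≥
      (1 / 4) *
          ip (fun z θ => Dzr f z θ * wgt z / Real.sin (2 * θ) ^ (η / 2))
            (fun z θ => Dzr f z θ * wgt z / Real.sin (2 * θ) ^ (η / 2)) -
        10 ^ 8 *
          (ip (fun z θ => Dth f z θ * wgt z / Real.sin (2 * θ) ^ (γ / 2))
              (fun z θ => Dth f z θ * wgt z / Real.sin (2 * θ) ^ (γ / 2)) +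
            ip (fun z θ => f z θ * wgt z / Real.sin (2 * θ) ^ (η / 2))
              (fun z θ => f z θ * wgt z / Real.sin (2 * θ) ^ (η / 2))) := by
  obtain ⟨hsm, a₀, b₀, ha₀, h0⟩ := hf
  subst hη
  have ha : 0 < a₀ / 2 := by positivity
  have haa : a₀ / 2 < a₀ := by linarith
  have hbb : b₀ < max a₀ b₀ + 1 := by linarith [le_max_right a₀ b₀]
  have hab : a₀ / 2 ≤ max a₀ b₀ + 1 := by linarith [le_max_left a₀ b₀]
  have h0' : ∀ z θ : ℝ, z ∉ Icc (a₀ / 2) (max a₀ b₀ + 1) → f z θ = 0 := fun z θ hz =>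
    h0 z θ fun h => hz (Icc_subset_Icc haa.le hbb.le h)
  have hη0 : (0 : ℝ) ≤ 99 / 100 := by norm_num
  have hη : (99 / 100 : ℝ) < 1 := by norm_num
  have hg0 := Dzr_eq_zero h0'
  have key := coercive_rect hα (by linarith) (γ := γ) (by linarith) (by linarith) ha haa hbb hab
    hsm h0 hf0
  have iX := integrable_Dzr_LGamT_mul hα.le ha hsm h0' hf0 hη0 hη
  rw [ip_weighted_sq ha hg0 (integrable_sq_mul_angWt ha (contDiff_Dzr hsm).continuous hη0 hη),
    ip_weighted_sq ha (Dth_eq_zero h0') (integrable_Dth_sq_mul_angWt ha hsm (by linarith)),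
    ip_weighted_sq ha h0' (integrable_sq_mul_angWt ha hsm.continuous hη0 hη)]
  simp only [angWt, ← div_eq_mul_inv] at iX key ⊢
  rw [ip_eq_integral_rectMeasure ha (fun z θ hz => by simp [hg0 z θ hz]) iX]
  exact key
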